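/- arXiv:2205.07129 — 3 statements merged into one kernel-verified Lean document; each statement's English description precedes it below -/
import Mathlib

section
/- (Theorem 1, part 2, ground form.) Let B be a ground program, and let e = ⟨⟨T, F⟩, C⟩ be a positive example, where T and F are sets of atoms (inclusions and exclusions) and C is a ground program (the context). Say a set H of ground constraints covers e if there exists a stable model I ∈ AS(B ∪ C ∪ H) with T ⊆ I and F ∩ I = ∅. Suppose H does not cover e, and H' is a set of ground constraints such that every constraint in H is subsumed by some constraint in H'. Then H' does not cover e. Equivalently, every H' that covers e satisfies the formula sbca(e,H): there exists r ∈ H such that no constraint of H' subsumes r. -/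
/-- A ground rule: head is `some a` for an atom `a`, or `none` for ⊥;
    `bpos`/`bneg` are the finite sets of positive/negative body atoms. -/
structure GroundRule (A : Type*) where
  head : Option A
  bpos : Finset A
  bneg : Finset A

/-- An interpretation `I` satisfies a ground rule `r` if, whenever the
    positive body holds and the negative body is disjoint from `I`,
    the head is an atom belonging to `I`. -/
def Satisfies {A : Type*} (I : Set A) (r : GroundRule A) : Prop :=
  ((r.bpos : Set A) ⊆ I ∧ ∀ a ∈ r.bneg, a ∉ I) → ∃ a, r.head = some a ∧ a ∈ I

/-- `I` is a model of a ground program `P` if it satisfies every rule of `P`. -/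
def IsModel {A : Type*} (P : Set (GroundRule A)) (I : Set A) : Prop :=
  ∀ r ∈ P, Satisfies I r

/-- The reduct `P^I`: keep `H(r) ← B⁺(r)` for each rule `r ∈ P` whose
    negative body is disjoint from `I`. -/
def reduct {A : Type*} (P : Set (GroundRule A)) (I : Set A) : Set (GroundRule A) :=
  {r' | ∃ r ∈ P, (∀ a ∈ r.bneg, a ∉ I) ∧ r' = ⟨r.head, r.bpos, ∅⟩}

/-- `I` is a stable model (answer set) of `P` if it is a subset-minimal
    model of the reduct `P^I`. -/
def IsStable {A : Type*} (P : Set (GroundRule A)) (I : Set A) : Prop :=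
  IsModel (reduct P I) I ∧ ∀ J : Set A, IsModel (reduct P I) J → J ⊆ I → J = I

/-- A constraint is a ground rule with head ⊥. -/
def IsConstraint {A : Type*} (r : GroundRule A) : Prop :=
  r.head = none

/-- `r'` subsumes `r` (for ground constraints). -/
def Subsumes {A : Type*} (r' r : GroundRule A) : Prop :=
  r'.bpos ⊆ r.bpos ∧ r'.bneg ⊆ r.bneg

/-- `H` covers the positive example `⟨⟨T, F⟩, C⟩` with respect to the background
    program `B` if some stable model of `B ∪ C ∪ H` extends `⟨T, F⟩`. -/
def Covers {A : Type*} (B : Set (GroundRule A)) (T F : Set A)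
    (C : Set (GroundRule A)) (H : Set (GroundRule A)) : Prop :=
  ∃ I : Set A, IsStable (B ∪ C ∪ H) I ∧ T ⊆ I ∧ F ∩ I = ∅

/-- Theorem 1, part 2 (ground form): if `H` does not cover the positive example
    `⟨⟨T, F⟩, C⟩` and every constraint of `H` is subsumed by some constraint of
    `H'`, then `H'` does not cover the example either. -/
theorem sbca_valid_positive {A : Type*} (B C : Set (GroundRule A))
    (T F : Set A) (hTF : Disjoint T F)
    (H H' : Set (GroundRule A))
    (hH : ∀ r ∈ H, IsConstraint r) (hH' : ∀ r ∈ H', IsConstraint r)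
    (hncov : ¬ Covers B T F C H)
    (hsub : ∀ r ∈ H, ∃ r' ∈ H', Subsumes r' r) :
    ¬ Covers B T F C H' := by
  rintro ⟨I, ⟨hM, hmin⟩, hT, hF⟩
  -- no constraint of `H'` has its body true in `I`
  have key : ∀ r ∈ H', (∀ a ∈ r.bneg, a ∉ I) → ¬ ((r.bpos : Set A) ⊆ I) := by
    intro r hr hn hp
    obtain ⟨a, ha, -⟩ := hM ⟨r.head, r.bpos, ∅⟩ ⟨r, Or.inr hr, hn, rfl⟩ ⟨hp, by simp⟩
    have hc : r.head = none := hH' r hr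
    simp [hc] at ha
  refine hncov ⟨I, ⟨?_, ?_⟩, hT, hF⟩
  · rintro _ ⟨r, hr | hr, hn, rfl⟩
    · exact hM _ ⟨r, Or.inl hr, hn, rfl⟩
    · rintro ⟨hp, -⟩
      obtain ⟨r', hr', hsp, hsn⟩ := hsub r hr
      exact absurd (fun a ha => hp (hsp ha)) (key r' hr' (fun a ha => hn a (hsn ha)))
  · intro J hJ hJI
    refine hmin J ?_ hJI
    rintro _ ⟨r, hr | hr, hn, rfl⟩
    · exact hJ _ ⟨r, Or.inl hr, hn, rfl⟩
    · rintro ⟨hp, -⟩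
      exact absurd (fun a ha => hJI (hp ha)) (key r hr hn)
end

section
/- Let A be a type of atoms and π : A ≃ A a permutation of atoms, extended to ground rules by applying π to the head (fixing ⊥) and elementwise to the positive and negative body. If a ground program P is invariant under π (the image of the set of rules of P under π equals P), then for every interpretation I ⊆ A: I is a stable model of P if and only if the image π(I) = { π(a) : a ∈ I } is a stable model of P. -/
/-- The action of a permutation `π` of atoms on a ground rule: apply `π` to the
    head (fixing ⊥) and elementwise to the positive and negative body. -/
def mapRule {A : Type*} [DecidableEq A] (π : A ≃ A) (r : GroundRule A) : GroundRule A :=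
  ⟨r.head.map π, r.bpos.image π, r.bneg.image π⟩

theorem isModel_reduct_iff {A : Type*} (P : Set (GroundRule A)) (I J : Set A) :
    IsModel (reduct P I) J ↔ ∀ r ∈ P, (∀ a ∈ r.bneg, a ∉ I) → (∀ a ∈ r.bpos, a ∈ J) →
      ∃ a, r.head = some a ∧ a ∈ J := by
  constructor
  · intro h r hr hn hp
    exact h ⟨r.head, r.bpos, ∅⟩ ⟨r, hr, hn, rfl⟩ ⟨fun a ha => hp a ha, by simp⟩
  · rintro h _ ⟨r, hr, hn, rfl⟩ ⟨hp, -⟩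
    exact h r hr hn (fun a ha => hp ha)

theorem isModel_reduct_image {A : Type*} [DecidableEq A] (π : A ≃ A)
    (P : Set (GroundRule A)) (hP : mapRule π '' P = P) (I J : Set A) :
    IsModel (reduct P ((π : A → A) '' I)) ((π : A → A) '' J) ↔ IsModel (reduct P I) J := by
  rw [isModel_reduct_iff, isModel_reduct_iff]
  conv_lhs => rw [← hP]
  rw [Set.forall_mem_image]
  refine forall₂_congr fun r _ => ?_
  simp [mapRule]

/-- If a ground program `P` is invariant under the permutation `π`, then `I` is a
    stable model of `P` iff `π '' I` is a stable model of `P`. -/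
theorem stable_iff_stable_image {A : Type*} [DecidableEq A] (π : A ≃ A)
    (P : Set (GroundRule A)) (hP : mapRule π '' P = P) (I : Set A) :
    IsStable P I ↔ IsStable P ((π : A → A) '' I) := by
  have himg : ∀ J : Set A, (π : A → A) '' ((π : A → A) ⁻¹' J) = J :=
    fun J => Set.image_preimage_eq J π.surjective
  unfold IsStable
  rw [isModel_reduct_image π P hP]
  refine and_congr_right fun _ => ⟨fun h J hJ hJI => ?_, fun h J hJ hJI => ?_⟩
  · rw [← himg J] at hJ hJI ⊢
    rw [isModel_reduct_image π P hP] at hJ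
    rw [h _ hJ ((Set.image_subset_image_iff π.injective).1 hJI)]
  · exact π.injective.image_injective
      (h _ ((isModel_reduct_image π P hP I J).2 hJ) (Set.image_mono hJI))
end

section
/- (Correctness of the ordered pGEQ encoding.) Let m be a natural number and p : ℕ → Prop a predicate such that p x implies 1 ≤ x ≤ m. Let G : ℕ → Prop be the least predicate satisfying the two rules: (i) for all x, p x implies G x; and (ii) for all x with 0 < x, G (x+1) implies G x. Then for every x with 0 < x: G x holds if and only if there exists x' with x ≤ x' ≤ m and p x'. -/
/-- Correctness of the ordered `pGEQ` encoding: let `G` be the least predicate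
    closed under the rules `G x if p x` and `G x if 0 < x and G (x+1)`, where
    `p x` implies `1 ≤ x ≤ m`. Then for every `x > 0`, `G x` holds iff `p x'`
    holds for some `x'` with `x ≤ x' ≤ m`. -/
theorem pGEQ_correct (m : ℕ) (p G : ℕ → Prop)
    (hp : ∀ x, p x → 1 ≤ x ∧ x ≤ m)
    (hG₁ : ∀ x, p x → G x)
    (hG₂ : ∀ x, 0 < x → G (x + 1) → G x)
    (hleast : ∀ Q : ℕ → Prop, (∀ x, p x → Q x) →
      (∀ x, 0 < x → Q (x + 1) → Q x) → ∀ x, G x → Q x) :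
    ∀ x, 0 < x → (G x ↔ ∃ x', x ≤ x' ∧ x' ≤ m ∧ p x') := by
  intro x hx
  constructor
  · refine hleast (fun x => ∃ x', x ≤ x' ∧ x' ≤ m ∧ p x') ?_ ?_ x
    · intro y hy
      exact ⟨y, le_refl y, (hp y hy).2, hy⟩
    · rintro y _ ⟨z, h1, h2, h3⟩
      exact ⟨z, by omega, h2, h3⟩
  · rintro ⟨z, h1, _, h3⟩
    have key : ∀ d y, 0 < y → G (y + d) → G y := by
      intro d
      induction d with
      | zero => intro y _ h; exact h
      | succ d ih =>
        intro y hy h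
        exact ih y hy (hG₂ (y + d) (by omega) h)
    apply key (z - x) x hx
    rw [Nat.add_sub_cancel' h1]
    exact hG₁ z h3
end
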